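/- For every μ > 0 and t > 0, the mean and variance of the GCP at the drifted Brownian first-passage time are given by ∑_{n=0}^∞ n p̂^μ(n,t) = c₁ t/μ and ∑_{n=0}^∞ n² p̂^μ(n,t) − (c₁ t/μ)² = (c₂ + c₁²/μ²) t/μ. -/

import Mathlib

noncomputable section
open MeasureTheory Real Finset

/-- The set Ω(k,n) of k-tuples (x₁,…,x_k) of nonnegative integers with
x₁ + 2x₂ + ⋯ + k x_k = n. -/
def Omega (k n : ℕ) : Finset (Fin k → ℕ) :=
  (Fintype.piFinset fun _ : Fin k => Finset.range (n + 1)).filter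
    (fun x => ∑ j, (j.val + 1) * x j = n)

/-- The state probabilities of the generalized counting process. -/
def gcp (k : ℕ) (l : Fin k → ℝ) (n : ℕ) (t : ℝ) : ℝ :=
  ∑ x ∈ Omega k n, ∏ j, ((l j * t) ^ (x j) / (Nat.factorial (x j) : ℝ) *
    Real.exp (-(l j * t)))

/-- Density of the first-passage time through level t of a Brownian motion with drift μ. -/
def fptDrift (μ s t : ℝ) : ℝ :=
  t * Real.exp (-(t - μ * s) ^ 2 / (2 * s)) / Real.sqrt (2 * Real.pi * s ^ 3)

/-- State probabilities of the GCP at the drifted Brownian first-passage time. -/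
def phatDrift (k : ℕ) (l : Fin k → ℝ) (μ : ℝ) (n : ℕ) (t : ℝ) : ℝ :=
  ∫ s in Set.Ioi (0 : ℝ), gcp k l n s * fptDrift μ s t

open Filter Topology

/-- FTC on (0,∞) with one-sided limits. -/
lemma ftc_aux (g g' : ℝ → ℝ) (L0 L : ℝ) (h0 : Tendsto g (𝓝[>] 0) (𝓝 L0))
    (hL : Tendsto g atTop (𝓝 L)) (hd : ∀ x ∈ Set.Ioi (0:ℝ), HasDerivAt g (g' x) x)
    (hp : ∀ x ∈ Set.Ioi (0:ℝ), 0 ≤ g' x) :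
    IntegrableOn g' (Set.Ioi 0) ∧ ∫ x in Set.Ioi 0, g' x = L - L0 := by
  have hev : ∀ x ∈ Set.Ioi (0:ℝ), Function.update g 0 L0 =ᶠ[𝓝 x] g := by
    intro x hx
    filter_upwards [Ioi_mem_nhds hx] with y hy
    exact Function.update_of_ne (ne_of_gt hy) _ _
  have hc : ContinuousWithinAt (Function.update g 0 L0) (Set.Ici 0) 0 := by
    rw [continuousWithinAt_update_same]
    simpa using h0
  have hd' : ∀ x ∈ Set.Ioi (0:ℝ), HasDerivAt (Function.update g 0 L0) (g' x) x :=
    fun x hx => (hd x hx).congr_of_eventuallyEq (hev x hx)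
  have hL' : Tendsto (Function.update g 0 L0) atTop (𝓝 L) := by
    refine hL.congr' ?_
    filter_upwards [eventually_gt_atTop 0] with y hy
    exact (Function.update_of_ne (ne_of_gt hy) _ _).symm
  refine ⟨integrableOn_Ioi_deriv_of_nonneg hc hd' hp hL', ?_⟩
  rw [integral_Ioi_of_hasDerivAt_of_nonneg hc hd' hp hL']
  simp

/-- Unnormalized error function. -/
def EE (x : ℝ) : ℝ := ∫ y in (0:ℝ)..x, Real.exp (-(1/2) * y ^ 2)

lemma EE_deriv (x : ℝ) : HasDerivAt EE (Real.exp (-(1/2) * x ^ 2)) x := by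
  have hc : Continuous (fun y : ℝ => Real.exp (-(1/2) * y ^ 2)) := by fun_prop
  exact intervalIntegral.integral_hasDerivAt_right (hc.intervalIntegrable _ _)
    (hc.stronglyMeasurableAtFilter _ _) hc.continuousAt

lemma EE_top : Tendsto EE atTop (𝓝 (√(2 * π) / 2)) := by
  have h := intervalIntegral_tendsto_integral_Ioi (f := fun y : ℝ => Real.exp (-(1/2) * y ^ 2))
    (μ := volume) 0 (integrable_exp_neg_mul_sq (by norm_num)).integrableOn tendsto_id
  rw [integral_gaussian_Ioi] at h
  convert h using 3
  congr 1; ring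

lemma EE_neg (x : ℝ) : EE (-x) = - EE x := by
  unfold EE
  have := intervalIntegral.integral_comp_neg (a := 0) (b := x)
    (fun y : ℝ => Real.exp (-(1/2) * y ^ 2))
  simp only [neg_sq, neg_zero] at this
  rw [this, intervalIntegral.integral_symm]

lemma EE_bot : Tendsto EE atBot (𝓝 (-(√(2 * π) / 2))) := by
  have h := (EE_top.comp tendsto_neg_atBot_atTop).neg
  refine h.congr fun x => ?_
  simp [EE_neg]

def aa (μ t s : ℝ) : ℝ := μ * √s - t / √s

lemma aa_top {μ : ℝ} (hμ : 0 < μ) (t : ℝ) : Tendsto (aa μ t) atTop atTop := by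
  have h1 : Tendsto (fun s => μ * √s) atTop atTop :=
    Tendsto.const_mul_atTop hμ Real.tendsto_sqrt_atTop
  have h2 : Tendsto (fun s => - (t / √s)) atTop (𝓝 (-0)) :=
    (Real.tendsto_sqrt_atTop.const_div_atTop t).neg
  exact h1.atTop_add h2

lemma sqrt_zero_right : Tendsto Real.sqrt (𝓝[>] 0) (𝓝[>] 0) := by
  refine tendsto_nhdsWithin_iff.2 ⟨?_, ?_⟩
  · have := (Real.continuous_sqrt.tendsto 0)
    rw [Real.sqrt_zero] at this
    exact this.mono_left nhdsWithin_le_nhds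
  · filter_upwards [self_mem_nhdsWithin] with s hs
    exact Real.sqrt_pos.2 hs

lemma aa_zero (μ : ℝ) {t : ℝ} (ht : 0 < t) : Tendsto (aa μ t) (𝓝[>] 0) atBot := by
  have h1 : Tendsto (fun s => μ * √s) (𝓝[>] 0) (𝓝 (μ * 0)) :=
    (sqrt_zero_right.mono_right nhdsWithin_le_nhds).const_mul μ
  have h2 : Tendsto (fun s => t * (√s)⁻¹) (𝓝[>] 0) atTop :=
    Tendsto.const_mul_atTop ht (tendsto_inv_nhdsGT_zero.comp sqrt_zero_right)
  exact h1.add_atBot (tendsto_neg_atTop_atBot.comp h2)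

lemma aa_zero' (μ : ℝ) {t : ℝ} (ht : 0 < t) : Tendsto (aa μ (-t)) (𝓝[>] 0) atTop := by
  have := tendsto_neg_atBot_atTop.comp (aa_zero (-μ) ht)
  refine this.congr fun s => ?_
  simp only [aa, Function.comp]; ring

lemma aa_deriv (μ t : ℝ) {s : ℝ} (hs : 0 < s) :
    HasDerivAt (aa μ t) (μ / (2 * √s) + t / (2 * s * √s)) s := by
  have hr : 0 < √s := Real.sqrt_pos.2 hs
  have h := Real.hasDerivAt_sqrt hs.ne'
  have h2 := (h.const_mul μ).sub ((h.inv hr.ne').const_mul t)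
  refine (h2.congr_deriv ?_)
  have : s = √s ^ 2 := (Real.sq_sqrt hs.le).symm
  rw [show 2 * s * √s = 2 * √s ^ 2 * √s by rw [← this]]
  field_simp
  ring

lemma aa_exp (μ t : ℝ) {s : ℝ} (hs : 0 < s) :
    Real.exp (2 * μ * t) * Real.exp (-(1/2) * aa μ (-t) s ^ 2)
      = Real.exp (-(1/2) * aa μ t s ^ 2) := by
  have hr : 0 < √s := Real.sqrt_pos.2 hs
  rw [← Real.exp_add]; congr 1
  unfold aa; field_simp; ring

lemma fpt_eq (μ t : ℝ) {s : ℝ} (hs : 0 < s) :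
    fptDrift μ s t = t * Real.exp (-(1/2) * aa μ t s ^ 2) / (√(2 * π) * (s * √s)) := by
  have hr : 0 < √s := Real.sqrt_pos.2 hs
  have : √s ^ 2 = s := (Real.sq_sqrt hs.le)
  unfold fptDrift
  congr 1
  · congr 2
    unfold aa
    have : (μ * √s - t / √s) ^ 2 = (t - μ * s)^2 / s := by
      generalize √s = r at *
      subst this; field_simp; ring
    rw [this]; field_simp
  · have h3 : √(s ^ 3) = s * √s := by
      rw [show s ^ 3 = s ^ 2 * s by ring, Real.sqrt_mul (by positivity), Real.sqrt_sq hs.le]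
    rw [Real.sqrt_mul (by positivity), h3]

/-- First moment of the first-passage density. -/
lemma fpt_mom1 (μ t : ℝ) (hμ : 0 < μ) (ht : 0 < t) :
    IntegrableOn (fun s => s * fptDrift μ s t) (Set.Ioi 0) ∧
      ∫ s in Set.Ioi 0, s * fptDrift μ s t = t / μ := by
  have hq : 0 < √(2 * π) := Real.sqrt_pos.2 (by positivity)
  have key := ftc_aux
    (fun s => t / (μ * √(2 * π)) * (EE (aa μ t s) + Real.exp (2 * μ * t) * EE (aa μ (-t) s)))
    (fun s => s * fptDrift μ s t) _ _
    (((EE_bot.comp (aa_zero μ ht)).add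
      ((EE_top.comp (aa_zero' μ ht)).const_mul (Real.exp (2 * μ * t)))).const_mul _)
    (((EE_top.comp (aa_top hμ t)).add
      ((EE_top.comp (aa_top hμ (-t))).const_mul (Real.exp (2 * μ * t)))).const_mul _)
    ?_ ?_
  · refine ⟨key.1, key.2.trans ?_⟩
    field_simp; ring
  · intro s (hs : 0 < s)
    have hr : 0 < √s := Real.sqrt_pos.2 hs
    have h := ((((EE_deriv _).comp s (aa_deriv μ t hs))).add
      (((EE_deriv _).comp s (aa_deriv μ (-t) hs)).const_mul
        (Real.exp (2 * μ * t)))).const_mul (t / (μ * √(2 * π)))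
    refine h.congr_deriv ?_
    rw [← mul_assoc (Real.exp (2 * μ * t)), aa_exp μ t hs, fpt_eq μ t hs]
    field_simp; ring
  · intro s (hs : 0 < s)
    rw [fpt_eq μ t hs]; positivity

lemma r_exp_top (μ t : ℝ) (hμ : 0 < μ) (ht : 0 < t) :
    Tendsto (fun s => √s * Real.exp (-(1/2) * aa μ t s ^ 2)) atTop (𝓝 0) := by
  have h1 : Tendsto (fun s : ℝ => μ ^ 2 / 2 * s) atTop atTop :=
    Tendsto.const_mul_atTop (by positivity) tendsto_id
  have h2 := ((Real.tendsto_pow_mul_exp_neg_atTop_nhds_zero 1).comp h1).const_mul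
    (2 / μ ^ 2 * Real.exp (μ * t))
  rw [mul_zero] at h2
  refine squeeze_zero' (Eventually.of_forall fun s => by positivity) ?_ h2
  filter_upwards [eventually_ge_atTop 1] with s hs
  have hs0 : 0 < s := by linarith
  have hr : 0 < √s := Real.sqrt_pos.2 hs0
  have hsq : √s ^ 2 = s := (Real.sq_sqrt hs0.le)
  have hle : √s ≤ s := by
    have : 1 ≤ √s := Real.one_le_sqrt.2 hs
    nlinarith
  have hexp : Real.exp (-(1/2) * aa μ t s ^ 2) ≤ Real.exp (μ * t) * Real.exp (-(μ ^ 2 / 2 * s)) := by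
    rw [← Real.exp_add]
    apply Real.exp_le_exp.2
    have : aa μ t s ^ 2 = μ ^ 2 * √s ^ 2 - 2 * μ * t + (t / √s) ^ 2 := by
      unfold aa; field_simp; ring
    rw [this, hsq]
    nlinarith [sq_nonneg (t / √s)]
  calc √s * Real.exp (-(1/2) * aa μ t s ^ 2)
      ≤ s * (Real.exp (μ * t) * Real.exp (-(μ ^ 2 / 2 * s))) := by gcongr
    _ = _ := by simp only [Function.comp]; field_simp

lemma r_exp_zero (μ t : ℝ) :
    Tendsto (fun s => √s * Real.exp (-(1/2) * aa μ t s ^ 2)) (𝓝[>] 0) (𝓝 0) := by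
  refine squeeze_zero (fun s => by positivity) (fun s => ?_)
    (sqrt_zero_right.mono_right nhdsWithin_le_nhds)
  have : Real.exp (-(1/2) * aa μ t s ^ 2) ≤ 1 := by
    apply Real.exp_le_one_iff.2; nlinarith [sq_nonneg (aa μ t s)]
  nlinarith [Real.sqrt_nonneg s]

/-- Second moment of the first-passage density. -/
lemma fpt_mom2 (μ t : ℝ) (hμ : 0 < μ) (ht : 0 < t) :
    IntegrableOn (fun s => s ^ 2 * fptDrift μ s t) (Set.Ioi 0) ∧
      ∫ s in Set.Ioi 0, s ^ 2 * fptDrift μ s t = t ^ 2 / μ ^ 2 + t / μ ^ 3 := by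
  have hq : 0 < √(2 * π) := Real.sqrt_pos.2 (by positivity)
  have key := ftc_aux
    (fun s => (t / (μ ^ 3 * √(2 * π)) *
        (EE (aa μ t s) + Real.exp (2 * μ * t) * EE (aa μ (-t) s))
      + t ^ 2 / (μ ^ 2 * √(2 * π)) *
        (EE (aa μ t s) - Real.exp (2 * μ * t) * EE (aa μ (-t) s)))
      - 2 * t / (μ ^ 2 * √(2 * π)) * (√s * Real.exp (-(1/2) * aa μ t s ^ 2)))
    (fun s => s ^ 2 * fptDrift μ s t) _ _
    (((((EE_bot.comp (aa_zero μ ht)).add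
      ((EE_top.comp (aa_zero' μ ht)).const_mul (Real.exp (2 * μ * t)))).const_mul _).add
      (((EE_bot.comp (aa_zero μ ht)).sub
      ((EE_top.comp (aa_zero' μ ht)).const_mul (Real.exp (2 * μ * t)))).const_mul _)).sub
      ((r_exp_zero μ t).const_mul _))
    (((((EE_top.comp (aa_top hμ t)).add
      ((EE_top.comp (aa_top hμ (-t))).const_mul (Real.exp (2 * μ * t)))).const_mul _).add
      (((EE_top.comp (aa_top hμ t)).sub
      ((EE_top.comp (aa_top hμ (-t))).const_mul (Real.exp (2 * μ * t)))).const_mul _)).sub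
      ((r_exp_top μ t hμ ht).const_mul _))
    ?_ ?_
  · refine ⟨key.1, key.2.trans ?_⟩
    field_simp; ring
  · intro s (hs : 0 < s)
    have hr : 0 < √s := Real.sqrt_pos.2 hs
    have hA := (EE_deriv _).comp s (aa_deriv μ t hs)
    have hB := ((EE_deriv _).comp s (aa_deriv μ (-t) hs)).const_mul (Real.exp (2 * μ * t))
    have hC := (Real.hasDerivAt_sqrt hs.ne').mul
      (((aa_deriv μ t hs).pow 2).const_mul (-(1/2))).exp
    have h := (((hA.add hB).const_mul (t / (μ ^ 3 * √(2 * π)))).add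
      ((hA.sub hB).const_mul (t ^ 2 / (μ ^ 2 * √(2 * π))))).sub
      (hC.const_mul (2 * t / (μ ^ 2 * √(2 * π))))
    refine h.congr_deriv ?_
    simp only [Pi.pow_apply, Nat.add_one_sub_one, pow_one, Nat.cast_ofNat]
    rw [← mul_assoc (Real.exp (2 * μ * t)), aa_exp μ t hs, fpt_eq μ t hs]
    generalize Real.exp (-(1/2) * aa μ t s ^ 2) = e
    have hsq : √s ^ 2 = s := (Real.sq_sqrt hs.le)
    unfold aa
    generalize √s = r at *
    subst hsq
    field_simp
    ring
  · intro s (hs : 0 < s)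
    rw [fpt_eq μ t hs]; positivity

/-- Poisson weights. -/
def pw (z : ℝ) (n : ℕ) : ℝ := z ^ n / (Nat.factorial n : ℝ) * Real.exp (-z)

lemma hs_congr {α : Type*} {f g : α → ℝ} {a b : ℝ} (h : HasSum f a) (hg : ∀ x, g x = f x)
    (hb : b = a) : HasSum g b := by
  rw [funext hg, hb]; exact h

lemma pw_nonneg {z : ℝ} (hz : 0 ≤ z) (n : ℕ) : 0 ≤ pw z n := by unfold pw; positivity

lemma pw_sum0 (z : ℝ) : HasSum (pw z) 1 := by
  have h : HasSum (fun n : ℕ => z ^ n / (Nat.factorial n : ℝ)) (Real.exp z) := by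
    rw [Real.exp_eq_exp_ℝ]; exact NormedSpace.expSeries_div_hasSum_exp z
  have := h.mul_right (Real.exp (-z))
  rwa [← Real.exp_add, add_neg_cancel, Real.exp_zero] at this

lemma pw_succ (z : ℝ) (n : ℕ) : ((n + 1 : ℕ) : ℝ) * pw z (n + 1) = z * pw z n := by
  unfold pw
  rw [Nat.factorial_succ]; push_cast
  have : (0:ℝ) < n + 1 := by positivity
  field_simp
  ring

lemma pw_sum1 (z : ℝ) : HasSum (fun n : ℕ => (n : ℝ) * pw z n) z := by
  rw [← hasSum_nat_add_iff' 1]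
  simp only [pw_succ]
  simpa using (pw_sum0 z).mul_left z

lemma pw_sum2 (z : ℝ) : HasSum (fun n : ℕ => (n : ℝ) ^ 2 * pw z n) (z + z ^ 2) := by
  rw [← hasSum_nat_add_iff' 1]
  have h : ∀ n : ℕ, ((n + 1 : ℕ) : ℝ) ^ 2 * pw z (n + 1) = z * (n * pw z n + pw z n) := by
    intro n
    rw [pow_two, mul_assoc, pw_succ]; push_cast; ring
  simp only [h]
  have := ((pw_sum1 z).add (pw_sum0 z)).mul_left z
  refine hs_congr this (fun _ => rfl) ?_
  simp; ring

lemma hasSum_mul_nonneg {α β : Type*} {f : α → ℝ} {g : β → ℝ} {a b : ℝ} (hf : HasSum f a)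
    (hg : HasSum g b) (hf0 : ∀ x, 0 ≤ f x) (hg0 : ∀ x, 0 ≤ g x) :
    HasSum (fun x : α × β => f x.1 * g x.2) (a * b) :=
  hf.mul hg (hf.summable.mul_of_nonneg hg.summable hf0 hg0)

/-- Moments of a weighted sum of independent Poisson variables. -/
lemma multi (k : ℕ) : ∀ (z a : Fin k → ℝ), (∀ j, 0 ≤ z j) → (∀ j, 0 ≤ a j) →
    HasSum (fun x : Fin k → ℕ => ∏ j, pw (z j) (x j)) 1 ∧
    HasSum (fun x : Fin k → ℕ => (∑ j, a j * x j) * ∏ j, pw (z j) (x j)) (∑ j, a j * z j) ∧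
    HasSum (fun x : Fin k → ℕ => (∑ j, a j * x j) ^ 2 * ∏ j, pw (z j) (x j))
      (∑ j, a j ^ 2 * z j + (∑ j, a j * z j) ^ 2) := by
  induction k with
  | zero =>
    intro z a _ _
    refine ⟨?_, ?_, ?_⟩
    · simpa using hasSum_unique (fun x : Fin 0 → ℕ => (1:ℝ))
    · simpa using hasSum_zero
    · simpa using hasSum_zero
  | succ k ih =>
    intro z a hz ha
    obtain ⟨h0, h1, h2⟩ := ih (fun j => z j.succ) (fun j => a j.succ) (fun j => hz _) (fun j => ha _)
    have w0 := pw_sum0 (z 0)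
    have w1 := pw_sum1 (z 0)
    have w2 := pw_sum2 (z 0)
    have n0 : ∀ n, 0 ≤ pw (z 0) n := pw_nonneg (hz 0)
    have n1 : ∀ n : ℕ, 0 ≤ (n:ℝ) * pw (z 0) n := fun n => mul_nonneg (by positivity) (n0 n)
    have n2 : ∀ n : ℕ, 0 ≤ (n:ℝ) ^ 2 * pw (z 0) n := fun n => mul_nonneg (by positivity) (n0 n)
    have m0 : ∀ x : Fin k → ℕ, 0 ≤ ∏ j : Fin k, pw (z j.succ) (x j) :=
      fun x => Finset.prod_nonneg fun j _ => pw_nonneg (hz _) _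
    have ms : ∀ x : Fin k → ℕ, 0 ≤ ∑ j : Fin k, a j.succ * (x j : ℝ) :=
      fun x => Finset.sum_nonneg fun j _ => mul_nonneg (ha _) (by positivity)
    have m1 := fun x : Fin k → ℕ => mul_nonneg (ms x) (m0 x)
    have m2 := fun x : Fin k → ℕ => mul_nonneg (pow_nonneg (ms x) 2) (m0 x)
    refine ⟨?_, ?_, ?_⟩
    · rw [← (Fin.consEquiv (fun _ : Fin (k+1) => ℕ)).hasSum_iff]
      refine hs_congr (hasSum_mul_nonneg w0 h0 n0 m0) (fun x => ?_) ?_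
      · simp [Fin.consEquiv, Fin.prod_univ_succ]
      · simp
    · rw [← (Fin.consEquiv (fun _ : Fin (k+1) => ℕ)).hasSum_iff]
      refine hs_congr (((hasSum_mul_nonneg w1 h0 n1 m0).mul_left (a 0)).add
        (hasSum_mul_nonneg w0 h1 n0 m1)) (fun x => ?_) ?_
      · simp [Fin.consEquiv, Fin.prod_univ_succ, Fin.sum_univ_succ]; ring
      · simp [Fin.sum_univ_succ]
    · rw [← (Fin.consEquiv (fun _ : Fin (k+1) => ℕ)).hasSum_iff]
      refine hs_congr ((((hasSum_mul_nonneg w2 h0 n2 m0).mul_left (a 0 ^ 2)).add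
        ((hasSum_mul_nonneg w1 h1 n1 m1).mul_left (2 * a 0))).add
        (hasSum_mul_nonneg w0 h2 n0 m2)) (fun x => ?_) ?_
      · simp [Fin.consEquiv, Fin.prod_univ_succ, Fin.sum_univ_succ]; ring
      · simp [Fin.sum_univ_succ]; ring

lemma mem_Omega (k n : ℕ) (x : Fin k → ℕ) : x ∈ Omega k n ↔ ∑ j, (j.val + 1) * x j = n := by
  unfold Omega
  rw [Finset.mem_filter, and_iff_right_iff_imp]
  intro h
  rw [Fintype.mem_piFinset]
  intro j
  rw [Finset.mem_range, Nat.lt_succ_iff, ← h]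
  calc x j ≤ (j.val + 1) * x j := Nat.le_mul_of_pos_left _ (by omega)
    _ ≤ _ := Finset.single_le_sum (f := fun j : Fin k => (j.val + 1) * x j)
      (fun _ _ => Nat.zero_le _) (Finset.mem_univ j)

/-- Regroup a sum over tuples along the value of the weighted sum. -/
lemma regroup (k r : ℕ) (P : (Fin k → ℕ) → ℝ) (A : ℝ)
    (h : HasSum (fun x : Fin k → ℕ => (∑ j, (j.val + 1 : ℝ) * x j) ^ r * P x) A) :
    HasSum (fun n : ℕ => (n : ℝ) ^ r * ∑ x ∈ Omega k n, P x) A := by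
  rw [← (Equiv.sigmaFiberEquiv (fun x : Fin k → ℕ => ∑ j, (j.val + 1) * x j)).hasSum_iff] at h
  refine h.sigma fun n => ?_
  have h2 := (Omega k n).hasSum (fun x => (n : ℝ) ^ r * P x)
  rw [← Finset.mul_sum] at h2
  let e : {x : Fin k → ℕ // ∑ j, (j.val + 1) * x j = n} ≃ {x // x ∈ Omega k n} :=
    Equiv.subtypeEquivRight fun x => (mem_Omega k n x).symm
  have h3 := e.hasSum_iff.2 h2
  convert h3 using 1
  ext ⟨x, hx⟩
  simp only [Function.comp, Equiv.sigmaFiberEquiv, e]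
  have : (∑ j, (j.val + 1 : ℝ) * x j) = n := by rw [← hx]; push_cast; rfl
  simp [this]

lemma swap (k : ℕ) (l : Fin k → ℝ) (hl : ∀ j, 0 < l j) (μ t : ℝ) (ht : 0 < t) (r : ℕ)
    (M : ℝ → ℝ) (hM : ∀ s, 0 < s → HasSum (fun n : ℕ => (n : ℝ) ^ r * gcp k l n s) (M s))
    (hi : IntegrableOn (fun s => M s * fptDrift μ s t) (Set.Ioi 0)) :
    HasSum (fun n : ℕ => (n : ℝ) ^ r * phatDrift k l μ n t)
      (∫ s in Set.Ioi 0, M s * fptDrift μ s t) := by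
  have hpos : ∀ s ∈ Set.Ioi (0:ℝ), ∀ n : ℕ,
      0 ≤ (n : ℝ) ^ r * gcp k l n s * fptDrift μ s t := by
    intro s (hs : 0 < s) n
    rw [fpt_eq μ t hs]
    have : 0 ≤ gcp k l n s := Finset.sum_nonneg fun x _ => Finset.prod_nonneg fun j _ => by
      have := hl j
      positivity
    positivity
  have hsum : ∀ s ∈ Set.Ioi (0:ℝ),
      HasSum (fun n : ℕ => (n : ℝ) ^ r * gcp k l n s * fptDrift μ s t) (M s * fptDrift μ s t) :=
    fun s hs => (hM s hs).mul_right _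
  have key := hasSum_integral_of_dominated_convergence (μ := volume.restrict (Set.Ioi (0:ℝ)))
    (F := fun (n : ℕ) s => (n : ℝ) ^ r * gcp k l n s * fptDrift μ s t)
    (f := fun s => M s * fptDrift μ s t)
    (fun (n : ℕ) s => (n : ℝ) ^ r * gcp k l n s * fptDrift μ s t)
    (fun n => by
      apply Measurable.aestronglyMeasurable
      unfold gcp fptDrift
      fun_prop)
    (fun n => by
      filter_upwards [ae_restrict_mem measurableSet_Ioi] with s hs
      rw [Real.norm_of_nonneg (hpos s hs n)])
    (by filter_upwards [ae_restrict_mem measurableSet_Ioi] with s hs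
        exact (hsum s hs).summable)
    (by refine hi.congr ?_
        filter_upwards [ae_restrict_mem measurableSet_Ioi] with s hs
        exact (hsum s hs).tsum_eq.symm)
    (by filter_upwards [ae_restrict_mem measurableSet_Ioi] with s hs
        exact hsum s hs)
  refine hs_congr key (fun n => ?_) rfl
  unfold phatDrift
  rw [← integral_const_mul]
  simp only [mul_assoc]

theorem gcp_fpt_drift_mean_var (k : ℕ) (hk : 1 ≤ k) (l : Fin k → ℝ) (hl : ∀ j, 0 < l j)
    (c₁ c₂ : ℝ) (hc₁ : c₁ = ∑ j, (j.val + 1 : ℝ) * l j)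
    (hc₂ : c₂ = ∑ j, ((j.val + 1 : ℝ)) ^ 2 * l j)
    (μ t : ℝ) (hμ : 0 < μ) (ht : 0 < t) :
    (∑' n : ℕ, (n : ℝ) * phatDrift k l μ n t) = c₁ * t / μ ∧
    (∑' n : ℕ, (n : ℝ) ^ 2 * phatDrift k l μ n t) - (c₁ * t / μ) ^ 2 =
      (c₂ + c₁ ^ 2 / μ ^ 2) * (t / μ) := by
  have hz : ∀ s : ℝ, 0 < s → ∀ j, 0 ≤ l j * s := fun s hs j => by have := hl j; positivity
  have ha : ∀ j : Fin k, (0:ℝ) ≤ (j.val + 1 : ℝ) := fun j => by positivity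
  obtain ⟨i1, e1⟩ := fpt_mom1 μ t hμ ht
  obtain ⟨i2, e2⟩ := fpt_mom2 μ t hμ ht
  have g1 : ∀ s, 0 < s → HasSum (fun n : ℕ => (n : ℝ) ^ 1 * gcp k l n s) (c₁ * s) := by
    intro s hs
    have h := (multi k (fun j => l j * s) (fun j => (j.val + 1 : ℝ)) (hz s hs) ha).2.1
    have h' := regroup k 1 (fun x => ∏ j, pw (l j * s) (x j)) (c₁ * s) (by
      refine hs_congr h (fun x => by simp only [pow_one]) ?_
      rw [hc₁, Finset.sum_mul]; exact Finset.sum_congr rfl fun j _ => by ring)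
    exact h'
  have g2 : ∀ s, 0 < s → HasSum (fun n : ℕ => (n : ℝ) ^ 2 * gcp k l n s)
      (c₂ * s + c₁ ^ 2 * s ^ 2) := by
    intro s hs
    have h := (multi k (fun j => l j * s) (fun j => (j.val + 1 : ℝ)) (hz s hs) ha).2.2
    have h' := regroup k 2 (fun x => ∏ j, pw (l j * s) (x j)) (c₂ * s + c₁ ^ 2 * s ^ 2) (by
      refine hs_congr h (fun x => rfl) ?_
      rw [← mul_pow, hc₁, hc₂, Finset.sum_mul, Finset.sum_mul]
      congr 1
      · exact Finset.sum_congr rfl fun j _ => by ring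
      · congr 1; exact Finset.sum_congr rfl fun j _ => by ring)
    exact h'
  have f1 : (fun s => c₁ * s * fptDrift μ s t) = fun s => c₁ * (s * fptDrift μ s t) := by
    ext s; ring
  have f2 : (fun s => (c₂ * s + c₁ ^ 2 * s ^ 2) * fptDrift μ s t)
      = fun s => c₂ * (s * fptDrift μ s t) + c₁ ^ 2 * (s ^ 2 * fptDrift μ s t) := by
    ext s; ring
  have s1 := swap k l hl μ t ht 1 _ g1 (by rw [f1]; exact i1.const_mul _)
  have s2 := swap k l hl μ t ht 2 _ g2 (by rw [f2]; exact (i1.const_mul _).add (i2.const_mul _))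
  rw [f1, integral_const_mul, e1] at s1
  rw [f2, integral_add (i1.const_mul _) (i2.const_mul _), integral_const_mul,
    integral_const_mul, e1, e2] at s2
  simp only [pow_one] at s1
  rw [s1.tsum_eq, s2.tsum_eq]
  constructor
  · ring
  · field_simp; ring
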